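/- arXiv:math/0412329 — 2 statements merged into one kernel-verified Lean document; each statement's English description precedes it below -/
import Mathlib

section
/- Let k be a field, let r > 2 and n ≥ 1, and let H = (f_i)_{i∈N} and H' = (f'_i)_{i∈N}, N = {1,…,n}, be two connected configurations of n hyperplanes in P^{r-1} over k such that H is more constrained than H'. Then there exists an index i₀ ∈ N with the following properties. Set W = ker f_{i₀}, W' = ker f'_{i₀}, M = {i ∈ N, i ≠ i₀ : f_i|_W ≠ 0} and M' = {i ∈ N, i ≠ i₀ : f'_i|_{W'} ≠ 0}. Then: (1) M ⊆ M'; (2) the restricted configuration R_{i₀}(H) = (f_i|_W)_{i∈M} of hyperplanes in the (r−1)-dimensional space W is connected, i.e. the only g ∈ GL(W) with (f_i|_W) ∘ g ∈ k^×·(f_i|_W) for all i ∈ M are the scalar maps, and likewise the restricted configuration R_{i₀}(H') = (f'_i|_{W'})_{i∈M'} is connected; (3) R_{i₀}(H) is more constrained than R_{i₀}(H'), i.e. for every subset S ⊆ M, if the family (f_i|_W)_{i∈S} is linearly independent then so is (f'_i|_{W'})_{i∈S}, and there exists a subset S ⊆ M for which (f'_i|_{W'})_{i∈S} is linearly independent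 but (f_i|_W)_{i∈S} is linearly dependent. -/
/-- A configuration of hyperplanes (nonzero linear functionals) indexed by `M ⊆ ι`
on a `k`-vector space `V` is *connected* (has no projective automorphisms) if the
only linear automorphisms `g` of `V` with `f i ∘ g ∈ kˣ · (f i)` for all `i ∈ M`
are the scalar maps. -/
def IsConnectedConfig (k : Type*) [Field k] {ι V : Type*} [AddCommGroup V] [Module k V]
    (M : Set ι) (f : ι → (V →ₗ[k] k)) : Prop :=
  ∀ g : V ≃ₗ[k] V,
    (∀ i ∈ M, ∃ c : kˣ, (f i).comp (g : V →ₗ[k] V) = (c : k) • f i) →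
    ∃ c : kˣ, ∀ v : V, g v = (c : k) • v

/-- A configuration `f` (on `V`) is *more constrained* than a configuration `f'`
(on `V'`), over the common index set `M`: every subset `S ⊆ M` that is linearly
independent for `f` is linearly independent for `f'`, but some subset `S ⊆ M` is
linearly independent for `f'` and linearly dependent for `f`. -/
def MoreConstrainedOn (k : Type*) [Field k] {ι V V' : Type*}
    [AddCommGroup V] [Module k V] [AddCommGroup V'] [Module k V']
    (M : Set ι) (f : ι → (V →ₗ[k] k)) (f' : ι → (V' →ₗ[k] k)) : Prop :=
  (∀ S : Set ι, S ⊆ M → LinearIndependent k (fun i : S => f i.1) →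
      LinearIndependent k (fun i : S => f' i.1)) ∧
  ∃ S : Set ι, S ⊆ M ∧ LinearIndependent k (fun i : S => f' i.1) ∧
      ¬ LinearIndependent k (fun i : S => f i.1)

open Module Submodule

section Separation

variable {k ι V : Type*} [Field k] [AddCommGroup V] [Module k V]

/-- A separation of the configuration `f` at `e`: the hyperplane `ker (f e)` is spanned by two
nonzero subspaces such that every member of `f` vanishes on at least one of them. -/
structure IsSeparation (f : ι → (V →ₗ[k] k)) (e : ι) (P Q : Submodule k V) : Prop where
  sup_eq : P ⊔ Q = LinearMap.ker (f e)
  left_ne_bot : P ≠ ⊥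
  right_ne_bot : Q ≠ ⊥
  le_ker : ∀ i, P ≤ LinearMap.ker (f i) ∨ Q ≤ LinearMap.ker (f i)

/-- A configuration is indecomposable if the space is not the sum of two nonzero subspaces
such that every member of the configuration vanishes on one of them. -/
def IsIndecomposable (f : ι → (V →ₗ[k] k)) : Prop :=
  ∀ P Q : Submodule k V, P ⊔ Q = ⊤ →
    (∀ i, P ≤ LinearMap.ker (f i) ∨ Q ≤ LinearMap.ker (f i)) → P = ⊥ ∨ Q = ⊥

theorem IsSeparation.symm {f : ι → (V →ₗ[k] k)} {e : ι} {P Q : Submodule k V}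
    (h : IsSeparation f e P Q) : IsSeparation f e Q P :=
  ⟨by rw [sup_comm, h.sup_eq], h.right_ne_bot, h.left_ne_bot, fun i => (h.le_ker i).symm⟩

theorem disjoint_of_forall_le_ker {f : ι → (V →ₗ[k] k)}
    (hspan : ∀ v, (∀ i, f i v = 0) → v = 0) {P Q : Submodule k V}
    (h : ∀ i, P ≤ LinearMap.ker (f i) ∨ Q ≤ LinearMap.ker (f i)) : Disjoint P Q := by
  rw [Submodule.disjoint_def]
  intro x hP hQ
  refine hspan x fun i => ?_
  rcases h i with h | h
  · exact h hP
  · exact h hQ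

theorem exists_smul_eq_of_ker_le {φ ψ : V →ₗ[k] k}
    (h : LinearMap.ker φ ≤ LinearMap.ker ψ) : ∃ a : k, a • φ = ψ := by
  by_cases hφ : φ = 0
  · refine ⟨0, ?_⟩
    ext y
    have : ψ y = 0 := h (by simp [hφ])
    simp [this]
  obtain ⟨x, hx⟩ := DFunLike.ne_iff.1 hφ
  have hx : φ x ≠ 0 := hx
  refine ⟨ψ x / φ x, ?_⟩
  ext y
  have hy : y - (φ y / φ x) • x ∈ LinearMap.ker φ := by simp [hx]
  have := h hy
  simp only [LinearMap.mem_ker, map_sub, map_smul, smul_eq_mul, sub_eq_zero] at this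
  simp only [LinearMap.smul_apply, smul_eq_mul, this]
  field_simp

theorem ker_eq_of_ker_le {φ ψ : V →ₗ[k] k} (hψ : ψ ≠ 0)
    (h : LinearMap.ker φ ≤ LinearMap.ker ψ) : LinearMap.ker φ = LinearMap.ker ψ := by
  obtain ⟨a, rfl⟩ := exists_smul_eq_of_ker_le h
  have ha : a ≠ 0 := by rintro rfl; simp at hψ
  exact (LinearMap.ker_smul φ a ha).symm

/-- In a spanning indecomposable configuration, for `u ∉ P` some hyperplane of the part of a
separation given by `P`, other than the base hyperplane, does not contain `u`. -/
theorem IsSeparation.exists_mem_left {f : ι → (V →ₗ[k] k)}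
    (hspan : ∀ v, (∀ i, f i v = 0) → v = 0) (hind : IsIndecomposable f)
    {e : ι} {P Q : Submodule k V} (h : IsSeparation f e P Q) {u : V} (hu : u ∉ P) :
    ∃ i, P ≤ LinearMap.ker (f i) ∧ f i u ≠ 0 ∧ LinearMap.ker (f i) ≠ LinearMap.ker (f e) := by
  by_contra! hcon
  have hPe : P ≤ LinearMap.ker (f e) := h.sup_eq ▸ le_sup_left
  have hQe : Q ≤ LinearMap.ker (f e) := h.sup_eq ▸ le_sup_right
  by_cases hue : f e u = 0
  · have : u ∈ P ⊔ Q := by rw [h.sup_eq]; exact hue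
    obtain ⟨p, hp, q, hq, rfl⟩ := mem_sup.1 this
    apply hu
    suffices q = 0 by simpa [this] using hp
    refine hspan q fun i => ?_
    rcases h.le_ker i with hi | hi
    · by_contra hqi
      have hpi : f i p = 0 := hi hp
      have hk := hcon i hi (by simpa [hpi] using hqi)
      have : q ∈ LinearMap.ker (f i) := hk ▸ hQe hq
      exact hqi this
    · exact hi hq
  · have := hind (P ⊔ span k {u}) Q ?_ ?_
    · rcases this with h1 | h1
      · exact h.left_ne_bot (le_bot_iff.1 (h1 ▸ le_sup_left))
      · exact h.right_ne_bot h1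
    · rw [sup_right_comm, h.sup_eq, eq_top_iff]
      intro y _
      refine mem_sup.2 ⟨y - (f e y / f e u) • u, by simp [hue], (f e y / f e u) • u,
        smul_mem _ _ (mem_span_singleton_self u), by simp⟩
    · intro i
      by_cases hQ : Q ≤ LinearMap.ker (f i)
      · exact Or.inr hQ
      · have hP := (h.le_ker i).resolve_right hQ
        refine Or.inl (sup_le hP ?_)
        rw [span_singleton_le_iff_mem]
        by_contra hui
        exact hQ (hcon i hP hui ▸ hQe)

/-- Two crossing separations give rise to a smaller one. -/
theorem IsSeparation.cross [FiniteDimensional k V] {f : ι → (V →ₗ[k] k)} (hf0 : ∀ i, f i ≠ 0)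
    (hspan : ∀ v, (∀ i, f i v = 0) → v = 0) (hind : IsIndecomposable f)
    {e c : ι} {P Q R S : Submodule k V} (he : IsSeparation f e P Q) (hc : IsSeparation f c R S)
    (hPc : P ≤ LinearMap.ker (f c)) (hRe : R ≤ LinearMap.ker (f e))
    (hne : LinearMap.ker (f c) ≠ LinearMap.ker (f e)) :
    IsSeparation f c (P ⊔ S) (Q ⊓ R) := by
  have hRc : R ≤ LinearMap.ker (f c) := hc.sup_eq ▸ le_sup_left
  have hSc : S ≤ LinearMap.ker (f c) := hc.sup_eq ▸ le_sup_right
  have hPe : P ≤ LinearMap.ker (f e) := he.sup_eq ▸ le_sup_left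
  have hQe : Q ≤ LinearMap.ker (f e) := he.sup_eq ▸ le_sup_right
  have hcover : ∀ i, P ⊔ S ≤ LinearMap.ker (f i) ∨ Q ⊓ R ≤ LinearMap.ker (f i) := by
    intro i
    rcases he.le_ker i with h1 | h1
    · rcases hc.le_ker i with h2 | h2
      · exact Or.inr (inf_le_right.trans h2)
      · exact Or.inl (sup_le h1 h2)
    · exact Or.inr (inf_le_left.trans h1)
  have hcover' : ∀ i, P ⊓ S ≤ LinearMap.ker (f i) ∨ Q ⊔ R ≤ LinearMap.ker (f i) := by
    intro i
    rcases he.le_ker i with h1 | h1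
    · exact Or.inl (inf_le_left.trans h1)
    · rcases hc.le_ker i with h2 | h2
      · exact Or.inr (sup_le h1 h2)
      · exact Or.inl (inf_le_right.trans h2)
  have hsup : P ⊔ S ⊔ Q ⊓ R = LinearMap.ker (f c) := by
    apply eq_of_le_of_finrank_le (sup_le (sup_le hPc hSc) (inf_le_right.trans hRc))
    have h1 := finrank_sup_add_finrank_inf_eq P S
    have h2 := finrank_sup_add_finrank_inf_eq Q R
    have h3 := finrank_sup_add_finrank_inf_eq P Q
    have h4 := finrank_sup_add_finrank_inf_eq R S
    have h5 := finrank_sup_add_finrank_inf_eq (P ⊔ S) (Q ⊓ R)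
    have h6 := finrank_sup_add_finrank_inf_eq (P ⊓ S) (Q ⊔ R)
    rw [he.sup_eq, (disjoint_of_forall_le_ker hspan he.le_ker).eq_bot, finrank_bot] at h3
    rw [hc.sup_eq, (disjoint_of_forall_le_ker hspan hc.le_ker).eq_bot, finrank_bot] at h4
    rw [(disjoint_of_forall_le_ker hspan hcover).eq_bot, finrank_bot] at h5
    rw [(disjoint_of_forall_le_ker hspan hcover').eq_bot, finrank_bot] at h6
    have h7 : finrank k ↥(P ⊓ S ⊔ (Q ⊔ R)) ≤ finrank k (LinearMap.ker (f e)) :=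
      finrank_mono (sup_le (inf_le_left.trans hPe) (sup_le hQe hRe))
    have h8 := Module.Dual.finrank_ker_add_one_of_ne_zero (hf0 e)
    have h9 := Module.Dual.finrank_ker_add_one_of_ne_zero (hf0 c)
    omega
  refine ⟨hsup, fun h => he.left_ne_bot (le_bot_iff.1 (h ▸ le_sup_left)), fun hbot => ?_, hcover⟩
  rw [hbot, sup_bot_eq] at hsup
  have hRP : R ≤ P := by
    intro x hx
    have hxe : x ∈ P ⊔ Q := by rw [he.sup_eq]; exact hRe hx
    obtain ⟨p, hp, q, hq, rfl⟩ := mem_sup.1 hxe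
    suffices q = 0 by simpa [this] using hp
    refine hspan q fun i => ?_
    rcases he.le_ker i with h1 | h1
    · have hpi : f i p = 0 := h1 hp
      have hpq : f i (p + q) = 0 := by
        rcases hc.le_ker i with h2 | h2
        · exact h2 hx
        · have : P ⊔ S ≤ LinearMap.ker (f i) := sup_le h1 h2
          rw [hsup] at this
          exact this (hRc hx)
      simpa [hpi] using hpq
    · exact h1 hq
  have hQc : ¬ Q ≤ LinearMap.ker (f c) := fun hQc => by
    have : LinearMap.ker (f e) ≤ LinearMap.ker (f c) := by
      rw [← he.sup_eq]; exact sup_le hPc hQc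
    exact hne (ker_eq_of_ker_le (hf0 c) this).symm
  have hbot' : R = ⊥ ∨ Q ⊔ S = ⊥ := hind R (Q ⊔ S) ?_ ?_
  · rcases hbot' with h1 | h1
    · exact hc.left_ne_bot h1
    · exact hc.right_ne_bot (le_bot_iff.1 (h1 ▸ le_sup_right))
  · rw [sup_left_comm, hc.sup_eq, eq_top_iff]
    obtain ⟨q, hq, hqc⟩ := SetLike.not_le_iff_exists.1 hQc
    have hqc : f c q ≠ 0 := hqc
    intro y _
    exact mem_sup.2 ⟨(f c y / f c q) • q, smul_mem _ _ hq, y - (f c y / f c q) • q,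
      by simp [hqc], by simp⟩
  · intro i
    rcases hc.le_ker i with h2 | h2
    · exact Or.inl h2
    · rcases he.le_ker i with h1 | h1
      · exact Or.inl (hRP.trans h1)
      · exact Or.inr (sup_le h1 h2)

/-- Each part of a separation of a spanning indecomposable configuration contains members at
which there is no separation, and these span the part. -/
theorem IsSeparation.exists_not_isSeparation [FiniteDimensional k V] {f : ι → (V →ₗ[k] k)}
    (hf0 : ∀ i, f i ≠ 0)
    (hspan : ∀ v, (∀ i, f i v = 0) → v = 0) (hind : IsIndecomposable f)
    {e : ι} {P Q : Submodule k V} (h : IsSeparation f e P Q) {u : V} (hu : u ∉ P) :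
    ∃ c, (¬ ∃ R S, IsSeparation f c R S) ∧ P ≤ LinearMap.ker (f c) ∧ f c u ≠ 0 := by
  induction P using WellFoundedGT.induction generalizing e Q with
  | ind P ih =>
    obtain ⟨c, hPc, hcu, hne⟩ := h.exists_mem_left hspan hind hu
    by_cases hgood : ∃ R S, IsSeparation f c R S
    · obtain ⟨R, S, hc, hRe⟩ :
          ∃ R S, IsSeparation f c R S ∧ R ≤ LinearMap.ker (f e) := by
        obtain ⟨R, S, hc⟩ := hgood
        rcases hc.le_ker e with h1 | h1
        · exact ⟨R, S, hc, h1⟩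
        · exact ⟨S, R, hc.symm, h1⟩
      have hnew := h.cross hf0 hspan hind hc hPc hRe hne
      have hlt : P < P ⊔ S := by
        refine lt_of_le_of_ne le_sup_left fun heq => hne ?_
        have hPe : P ≤ LinearMap.ker (f e) := h.sup_eq ▸ le_sup_left
        have hSP : S ≤ P := heq ▸ le_sup_right
        apply ker_eq_of_ker_le (hf0 e)
        rw [← hc.sup_eq]
        exact sup_le hRe (hSP.trans hPe)
      have hu' : u ∉ P ⊔ S := fun hmem => hcu <| by
        have : P ⊔ S ≤ LinearMap.ker (f c) := hnew.sup_eq ▸ le_sup_left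
        exact this hmem
      obtain ⟨c', h1, h2, h3⟩ := ih _ hlt hnew hu'
      exact ⟨c', h1, le_sup_left.trans h2, h3⟩
    · exact ⟨c, hgood, hPc, hcu⟩

end Separation

section Connected

variable {k ι V : Type*} [Field k] [AddCommGroup V] [Module k V]

/-- A connected configuration on a space of dimension at least two is spanning. -/
theorem IsConnectedConfig.eq_zero_of_forall [FiniteDimensional k V] (hV : 1 < finrank k V)
    {f : ι → (V →ₗ[k] k)} (h : IsConnectedConfig k Set.univ f)
    (v : V) (hv : ∀ i, f i v = 0) : v = 0 := by
  by_contra hv0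
  obtain ⟨w, hw⟩ : ∃ w, w ∉ span k {v} := by
    by_contra! hw
    have h1 : span k {v} = ⊤ := eq_top_iff.2 fun w _ => hw w
    have h2 := finrank_span_singleton (K := k) hv0
    rw [h1, finrank_top] at h2
    omega
  obtain ⟨φ, hφw, hφ⟩ := Submodule.exists_le_ker_of_notMem hw
  have hφv : φ v = 0 := hφ (mem_span_singleton_self v)
  obtain ⟨c, hc⟩ := h (LinearEquiv.transvection hφv) fun i _ =>
    ⟨1, by ext x; simp [LinearMap.transvection.apply, hv i]⟩
  have h1 := hc v
  have h2 := hc w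
  simp only [LinearEquiv.transvection.apply, hφv, zero_smul, add_zero] at h1 h2
  have hc1 : (c : k) = 1 := by
    by_contra hne
    have : ((c : k) - 1) • v = 0 := by rw [sub_smul, ← h1, one_smul, sub_self]
    rcases smul_eq_zero.1 this with h3 | h3
    · exact hne (sub_eq_zero.1 h3)
    · exact hv0 h3
  rw [hc1, one_smul, add_eq_left] at h2
  rcases smul_eq_zero.1 h2 with h3 | h3
  · exact hφw h3
  · exact hv0 h3

/-- If the field has a unit other than one, a decomposition yields a nonscalar automorphism. -/
theorem IsConnectedConfig.eq_bot_or_eq_bot {M : Set ι} {f : ι → (V →ₗ[k] k)}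
    (h : IsConnectedConfig k M f) {u : k} (hu0 : u ≠ 0) (hu1 : u ≠ 1) {P Q : Submodule k V}
    (hPQ : IsCompl P Q)
    (hcov : ∀ i ∈ M, P ≤ LinearMap.ker (f i) ∨ Q ≤ LinearMap.ker (f i)) :
    P = ⊥ ∨ Q = ⊥ := by
  by_contra! hne
  obtain ⟨p, hp, hp0⟩ := P.ne_bot_iff.1 hne.1
  obtain ⟨q, hq, hq0⟩ := Q.ne_bot_iff.1 hne.2
  let E := prodEquivOfIsCompl P Q hPQ
  let g : V ≃ₗ[k] V := E.symm.trans
    (((LinearEquiv.smulOfNeZero k P u hu0).prodCongr (LinearEquiv.refl k Q)).trans E)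
  have hg : ∀ (p : P) (q : Q), g (p + q) = u • (p : V) + q := by
    intro p q
    have : (p + q : V) = E (p, q) := by simp [E]
    rw [this]
    simp only [g, LinearEquiv.trans_apply, LinearEquiv.symm_apply_apply]
    simp [E]
  have hgP : ∀ x ∈ P, g x = u • x := fun x hx => by simpa using hg ⟨x, hx⟩ 0
  have hgQ : ∀ x ∈ Q, g x = x := fun x hx => by simpa using hg 0 ⟨x, hx⟩
  have hext : ∀ φ ψ : V →ₗ[k] k, (∀ x ∈ P, φ x = ψ x) → (∀ x ∈ Q, φ x = ψ x) → φ = ψ := by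
    intro φ ψ h1 h2
    ext x
    have hx : x ∈ P ⊔ Q := by rw [hPQ.sup_eq_top]; trivial
    obtain ⟨a, ha, b, hb, rfl⟩ := mem_sup.1 hx
    rw [map_add, map_add, h1 a ha, h2 b hb]
  obtain ⟨c, hc⟩ := h g fun i hi => by
    rcases hcov i hi with h1 | h1
    · refine ⟨1, hext _ _ (fun x hx => ?_) (fun x hx => ?_)⟩
      · have : f i x = 0 := h1 hx
        simp [hgP x hx, this]
      · simp [hgQ x hx]
    · refine ⟨Units.mk0 u hu0, hext _ _ (fun x hx => ?_) (fun x hx => ?_)⟩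
      · simp [hgP x hx]
      · have : f i x = 0 := h1 hx
        simp [hgQ x hx, this]
  have h1 := hc p
  have h2 := hc q
  rw [hgP p hp] at h1
  rw [hgQ q hq] at h2
  have e1 : u = c := smul_left_injective k hp0 h1
  have e2 : (1 : k) = c := smul_left_injective k hq0 (by simpa using h2)
  exact hu1 (e1.trans e2.symm)

/-- A spanning configuration that is not connected decomposes. -/
theorem exists_isCompl_of_not_isConnectedConfig [FiniteDimensional k V] {M : Set ι}
    {f : ι → (V →ₗ[k] k)}
    (hspan : ∀ v, (∀ i ∈ M, f i v = 0) → v = 0) (h : ¬ IsConnectedConfig k M f) :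
    (∃ u : k, u ≠ 0 ∧ u ≠ 1) ∧ ∃ P Q : Submodule k V, IsCompl P Q ∧ P ≠ ⊥ ∧ Q ≠ ⊥ ∧
      ∀ i ∈ M, P ≤ LinearMap.ker (f i) ∨ Q ≤ LinearMap.ker (f i) := by
  unfold IsConnectedConfig at h
  push Not at h
  obtain ⟨g, hg, hns⟩ := h
  choose! c hc using hg
  have hc' : ∀ i ∈ M, ∀ x, f i (g x) = c i * f i x := fun i hi x => by
    simpa using LinearMap.congr_fun (hc i hi) x
  obtain ⟨v, hv⟩ := hns 1
  have hv0 : v ≠ 0 := by rintro rfl; simp at hv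
  obtain ⟨i₁, hi₁, hfi₁⟩ : ∃ i ∈ M, f i v ≠ 0 := by
    by_contra! hcon
    exact hv0 (hspan v hcon)
  let T : V →ₗ[k] V := (g : V →ₗ[k] V) - (c i₁ : k) • LinearMap.id
  have hT : ∀ i ∈ M, ∀ x, f i (T x) = (c i - c i₁) * f i x := fun i hi x => by
    simp [T, hc' i hi, sub_mul]
  have hcov : ∀ i ∈ M, LinearMap.ker T ≤ LinearMap.ker (f i) ∨
      LinearMap.range T ≤ LinearMap.ker (f i) := by
    intro i hi
    by_cases hci : (c i : k) = c i₁
    · right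
      rintro _ ⟨x, rfl⟩
      simp [hT i hi, hci]
    · left
      intro x hx
      have := hT i hi x
      rw [LinearMap.mem_ker.1 hx, map_zero, eq_comm, mul_eq_zero] at this
      exact this.resolve_left (sub_ne_zero.2 hci)
  have hdisj : Disjoint (LinearMap.ker T) (LinearMap.range T) := by
    rw [Submodule.disjoint_def]
    intro x h1 h2
    refine hspan x fun i hi => ?_
    rcases hcov i hi with h | h
    · exact h h1
    · exact h h2
  have hrn := T.finrank_range_add_finrank_ker
  have hcompl : IsCompl (LinearMap.ker T) (LinearMap.range T) := by
    refine ⟨hdisj, codisjoint_iff.2 (eq_top_of_finrank_eq ?_)⟩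
    have := finrank_sup_add_finrank_inf_eq (LinearMap.ker T) (LinearMap.range T)
    rw [hdisj.eq_bot, finrank_bot] at this
    omega
  obtain ⟨w, hw⟩ := hns (c i₁)
  have hTw : T w ≠ 0 := by
    simpa [T, sub_eq_zero] using hw
  refine ⟨?_, LinearMap.ker T, LinearMap.range T, hcompl, fun hbot => ?_, fun hbot => ?_, hcov⟩
  · obtain ⟨j, hj, hfj⟩ : ∃ j ∈ M, f j (T w) ≠ 0 := by
      by_contra! hcon
      exact hTw (hspan _ hcon)
    refine ⟨c j * (c i₁ : k)⁻¹, by simp, fun h1 => hfj ?_⟩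
    rw [hT j hj, (mul_inv_eq_one₀ (c i₁).ne_zero).1 h1, sub_self, zero_mul]
  · have htop : LinearMap.range T = ⊤ := by
      simpa [hbot] using hcompl.sup_eq_top
    have hv' : v ∈ LinearMap.range T := htop ▸ trivial
    obtain ⟨x, rfl⟩ := hv'
    exact hfi₁ (by simp [hT i₁ hi₁])
  · have : T w ∈ LinearMap.range T := ⟨w, rfl⟩
    rw [hbot] at this
    exact hTw (by simpa using this)

end Connected

section Restriction

variable {k ι V : Type*} [Field k] [AddCommGroup V] [Module k V]

/-- The restriction of the configuration `f` to the subspace `W` is connected. -/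
def IsConnectedOn (f : ι → (V →ₗ[k] k)) (W : Submodule k V) : Prop :=
  IsConnectedConfig k {i | (f i).domRestrict W ≠ 0} (fun i => (f i).domRestrict W)

theorem setOf_ne_and_domRestrict_ne_zero (f : ι → (V →ₗ[k] k)) (e : ι) :
    {i | i ≠ e ∧ (f i).domRestrict (LinearMap.ker (f e)) ≠ 0} =
      {i | (f i).domRestrict (LinearMap.ker (f e)) ≠ 0} := by
  ext i
  simp only [Set.mem_ofPred_eq, and_iff_right_iff_imp]
  rintro h rfl
  apply h
  ext x
  exact x.2

theorem exists_isSeparation_of_not_isConnectedOn [FiniteDimensional k V] {f : ι → (V →ₗ[k] k)}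
    (hspan : ∀ v, (∀ i, f i v = 0) → v = 0) {e : ι}
    (h : ¬ IsConnectedOn f (LinearMap.ker (f e))) :
    (∃ u : k, u ≠ 0 ∧ u ≠ 1) ∧ ∃ P Q, IsSeparation f e P Q := by
  obtain ⟨hu, P, Q, hPQ, hP, hQ, hcov⟩ := exists_isCompl_of_not_isConnectedConfig
    (fun v hv => Subtype.ext <| hspan v fun i => by
      by_cases hi : (f i).domRestrict (LinearMap.ker (f e)) = 0
      · exact LinearMap.congr_fun hi v
      · exact hv i hi) h
  refine ⟨hu, P.map (Submodule.subtype _), Q.map (Submodule.subtype _), ?_, ?_, ?_, fun i => ?_⟩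
  · rw [← Submodule.map_sup, hPQ.sup_eq_top, Submodule.map_subtype_top]
  · exact fun h0 => hP <|
      map_injective_of_injective (subtype_injective _) (h0.trans (Submodule.map_bot _).symm)
  · exact fun h0 => hQ <|
      map_injective_of_injective (subtype_injective _) (h0.trans (Submodule.map_bot _).symm)
  · by_cases hi : (f i).domRestrict (LinearMap.ker (f e)) = 0
    · left
      rintro _ ⟨x, -, rfl⟩
      exact LinearMap.congr_fun hi x
    · refine (hcov i hi).imp ?_ ?_
      · rintro hle _ ⟨x, hx, rfl⟩
        exact hle hx
      · rintro hle _ ⟨x, hx, rfl⟩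
        exact hle hx

theorem IsSeparation.not_isConnectedOn {f : ι → (V →ₗ[k] k)}
    (hspan : ∀ v, (∀ i, f i v = 0) → v = 0) {e : ι} {P Q : Submodule k V}
    (h : IsSeparation f e P Q) {u : k} (hu0 : u ≠ 0) (hu1 : u ≠ 1) :
    ¬ IsConnectedOn f (LinearMap.ker (f e)) := by
  intro hc
  have hPe : P ≤ LinearMap.ker (f e) := h.sup_eq ▸ le_sup_left
  have hQe : Q ≤ LinearMap.ker (f e) := h.sup_eq ▸ le_sup_right
  have hcompl : IsCompl (P.submoduleOf (LinearMap.ker (f e)))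
      (Q.submoduleOf (LinearMap.ker (f e))) := by
    constructor
    · rw [Submodule.disjoint_def]
      intro x hx hy
      exact Subtype.ext
        (Submodule.disjoint_def.1 (disjoint_of_forall_le_ker hspan h.le_ker) x hx hy)
    · rw [codisjoint_iff, ← submoduleOf_sup_of_le hPe hQe, h.sup_eq, submoduleOf_self]
  have hcov : ∀ i, P.submoduleOf (LinearMap.ker (f e)) ≤
        LinearMap.ker ((f i).domRestrict (LinearMap.ker (f e))) ∨
      Q.submoduleOf (LinearMap.ker (f e)) ≤
        LinearMap.ker ((f i).domRestrict (LinearMap.ker (f e))) := fun i =>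
    (h.le_ker i).imp (fun hle x hx => hle hx) (fun hle x hx => hle hx)
  rcases hc.eq_bot_or_eq_bot hu0 hu1 hcompl fun i _ => hcov i with h1 | h1
  · refine h.left_ne_bot (eq_bot_iff.2 fun x hx => ?_)
    have : (⟨x, hPe hx⟩ : LinearMap.ker (f e)) ∈ P.submoduleOf (LinearMap.ker (f e)) := hx
    rw [h1] at this
    simpa using this
  · refine h.right_ne_bot (eq_bot_iff.2 fun x hx => ?_)
    have : (⟨x, hQe hx⟩ : LinearMap.ker (f e)) ∈ Q.submoduleOf (LinearMap.ker (f e)) := hx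
    rw [h1] at this
    simpa using this

theorem IsConnectedConfig.isIndecomposable {f : ι → (V →ₗ[k] k)}
    (h : IsConnectedConfig k Set.univ f) (hspan : ∀ v, (∀ i, f i v = 0) → v = 0)
    {u : k} (hu0 : u ≠ 0) (hu1 : u ≠ 1) : IsIndecomposable f := fun _ _ hPQ hcov =>
  h.eq_bot_or_eq_bot hu0 hu1
    ⟨disjoint_of_forall_le_ker hspan hcov, codisjoint_iff.2 hPQ⟩ fun i _ => hcov i

/-- If the restriction at `e` is not connected, each part of some separation at `e` is spanned
by members at which the restriction is connected. -/
theorem exists_isSeparation_and_isConnectedOn [FiniteDimensional k V] {f : ι → (V →ₗ[k] k)}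
    (hf0 : ∀ i, f i ≠ 0) (hspan : ∀ v, (∀ i, f i v = 0) → v = 0)
    (hconn : IsConnectedConfig k Set.univ f) {e : ι}
    (he : ¬ IsConnectedOn f (LinearMap.ker (f e))) :
    ∃ P Q, IsSeparation f e P Q ∧
      (∀ w ∉ P, ∃ c, IsConnectedOn f (LinearMap.ker (f c)) ∧
        P ≤ LinearMap.ker (f c) ∧ f c w ≠ 0) ∧
      (∀ w ∉ Q, ∃ c, IsConnectedOn f (LinearMap.ker (f c)) ∧
        Q ≤ LinearMap.ker (f c) ∧ f c w ≠ 0) := by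
  obtain ⟨⟨u, hu0, hu1⟩, P, Q, h⟩ := exists_isSeparation_of_not_isConnectedOn hspan he
  have hind := hconn.isIndecomposable hspan hu0 hu1
  have key : ∀ {P Q : Submodule k V}, IsSeparation f e P Q →
      ∀ w ∉ P, ∃ c, IsConnectedOn f (LinearMap.ker (f c)) ∧
        P ≤ LinearMap.ker (f c) ∧ f c w ≠ 0 := by
    intro P Q h w hw
    obtain ⟨c, hc, h1, h2⟩ := h.exists_not_isSeparation hf0 hspan hind hw
    refine ⟨c, ?_, h1, h2⟩
    by_contra hcc
    exact hc (exists_isSeparation_of_not_isConnectedOn hspan hcc).2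
  exact ⟨P, Q, h, key h, key h.symm⟩

/-- The members of a connected configuration at which the restriction is connected span. -/
theorem exists_isConnectedOn [FiniteDimensional k V] {f : ι → (V →ₗ[k] k)}
    (hf0 : ∀ i, f i ≠ 0) (hspan : ∀ v, (∀ i, f i v = 0) → v = 0)
    (hconn : IsConnectedConfig k Set.univ f) {u : V} (hu : u ≠ 0) :
    ∃ c, IsConnectedOn f (LinearMap.ker (f c)) ∧ f c u ≠ 0 := by
  obtain ⟨e, he⟩ : ∃ e, f e u ≠ 0 := by
    by_contra! hcon
    exact hu (hspan u hcon)
  by_cases hg : IsConnectedOn f (LinearMap.ker (f e))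
  · exact ⟨e, hg, he⟩
  · obtain ⟨P, Q, h, hP, -⟩ := exists_isSeparation_and_isConnectedOn hf0 hspan hconn hg
    have hPe : P ≤ LinearMap.ker (f e) := h.sup_eq ▸ le_sup_left
    obtain ⟨c, hc, -, hcu⟩ := hP u fun hu => he (hPe hu)
    exact ⟨c, hc, hcu⟩

end Restriction

section Independence

variable {k ι V V' : Type*} [Field k] [AddCommGroup V] [Module k V] [AddCommGroup V'] [Module k V']

/-- The common zero space of the members of `f` indexed by `S`. -/
def commonKer (f : ι → (V →ₗ[k] k)) (S : Set ι) : Submodule k V :=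
  (span k (f '' S) : Submodule k (Dual k V)).dualCoannihilator

theorem mem_commonKer {f : ι → (V →ₗ[k] k)} {S : Set ι} {v : V} :
    v ∈ commonKer f S ↔ ∀ i ∈ S, f i v = 0 := by
  rw [commonKer, ← SetLike.mem_coe, coe_dualCoannihilator_span]
  simp

theorem finrank_span_add_finrank_commonKer [FiniteDimensional k V]
    (f : ι → (V →ₗ[k] k)) (S : Set ι) :
    finrank k (span k (f '' S)) + finrank k (commonKer f S) = finrank k V :=
  Subspace.finrank_add_finrank_dualCoannihilator_eq (span k (f '' S))

theorem linearIndepOn_iff_finrank_commonKer_add_ncard [Finite ι] [FiniteDimensional k V]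
    {f : ι → (V →ₗ[k] k)} {S : Set ι} :
    LinearIndepOn k f S ↔ finrank k (commonKer f S) + S.ncard = finrank k V := by
  have := Fintype.ofFinite S
  have h1 := finrank_span_add_finrank_commonKer f S
  rw [LinearIndepOn, linearIndependent_iff_card_eq_finrank_span, ← Nat.card_eq_fintype_card,
    Nat.card_coe_set_eq, Set.finrank, ← Set.image_eq_range]
  constructor
  · intro h
    rw [← h1, ← h, add_comm]
  · intro h
    rw [← h1, add_comm] at h
    exact Nat.add_right_cancel h

theorem linearIndepOn_domRestrict_ker_iff {f : ι → (V →ₗ[k] k)} {e : ι} (he : f e ≠ 0)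
    {S : Set ι} (heS : e ∉ S) :
    LinearIndepOn k (fun i => (f i).domRestrict (LinearMap.ker (f e))) S ↔
      LinearIndepOn k f (insert e S) := by
  let L : Dual k V →ₗ[k] Dual k (LinearMap.ker (f e)) :=
    (LinearMap.ker (f e)).dualRestrict
  have hker : ∀ φ : Dual k V, φ ∈ LinearMap.ker L ↔ ∃ a : k, a • f e = φ := by
    intro φ
    constructor
    · intro hφ
      exact exists_smul_eq_of_ker_le fun x hx => LinearMap.congr_fun hφ ⟨x, hx⟩
    · rintro ⟨a, rfl⟩
      ext x
      have hx : f e x = 0 := x.2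
      simp [L, hx]
  rw [linearIndepOn_insert heS]
  change LinearIndependent k (L ∘ fun i : S => f i) ↔ _
  rw [Set.image_eq_range]
  constructor
  · intro h
    refine ⟨h.of_comp, fun hmem => he ?_⟩
    exact Submodule.disjoint_def.1 (Submodule.range_ker_disjoint h) _ hmem ((hker _).2 ⟨1, one_smul _ _⟩)
  · rintro ⟨h1, h2⟩
    refine h1.map ?_
    rw [Submodule.disjoint_def]
    intro φ hφ hL
    obtain ⟨a, rfl⟩ := (hker φ).1 hL
    by_cases ha : a = 0
    · rw [ha, zero_smul]
    · exact absurd ((smul_mem_iff _ ha).1 hφ) h2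

theorem linearIndepOn_pair_iff_ker_ne {f : ι → (V →ₗ[k] k)} {i j : ι} (hij : i ≠ j)
    (hi : f i ≠ 0) (hj : f j ≠ 0) :
    LinearIndepOn k f {i, j} ↔ LinearMap.ker (f i) ≠ LinearMap.ker (f j) := by
  rw [linearIndepOn_pair_iff _ hij hi]
  constructor
  · intro h heq
    obtain ⟨a, ha⟩ := exists_smul_eq_of_ker_le heq.le
    exact h a ha
  · rintro h a ha
    exact h (ker_eq_of_ker_le hj fun x hx => by simp [← ha, LinearMap.mem_ker.1 hx])

end Independence

section Comparison

variable {k ι V V' : Type*} [Field k] [AddCommGroup V] [Module k V] [AddCommGroup V'] [Module k V']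
  [FiniteDimensional k V] [FiniteDimensional k V']

/-- The common zero spaces can only shrink when passing to a less constrained configuration. -/
theorem finrank_commonKer_le [Finite ι] {f : ι → (V →ₗ[k] k)} {f' : ι → (V' →ₗ[k] k)}
    (hdim : finrank k V = finrank k V')
    (h : ∀ S : Set ι, LinearIndepOn k f S → LinearIndepOn k f' S) (I : Set ι) :
    finrank k (commonKer f' I) ≤ finrank k (commonKer f I) := by
  obtain ⟨B, hBI, -, hspan, hB⟩ :=
    exists_linearIndepOn_extension (linearIndepOn_empty k f) (Set.empty_subset I)
  have h1 := linearIndepOn_iff_finrank_commonKer_add_ncard.1 hB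
  have h2 := linearIndepOn_iff_finrank_commonKer_add_ncard.1 (h B hB)
  have h3 : finrank k (commonKer f' I) ≤ finrank k (commonKer f' B) :=
    finrank_mono fun v hv => mem_commonKer.2 fun i hi => mem_commonKer.1 hv i (hBI hi)
  have h4 : finrank k (commonKer f B) ≤ finrank k (commonKer f I) :=
    finrank_mono (dualCoannihilator_anti (span_le.2 hspan))
  omega

/-- Connectedness of a restriction passes to less constrained configurations. -/
theorem IsConnectedOn.of_le [Finite ι] {f : ι → (V →ₗ[k] k)} {f' : ι → (V' →ₗ[k] k)}
    (hdim : finrank k V = finrank k V')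
    (hf0 : ∀ i, f i ≠ 0) (hf0' : ∀ i, f' i ≠ 0)
    (hspan : ∀ v, (∀ i, f i v = 0) → v = 0) (hspan' : ∀ v, (∀ i, f' i v = 0) → v = 0)
    (h : ∀ S : Set ι, LinearIndepOn k f S → LinearIndepOn k f' S) {e : ι}
    (he : IsConnectedOn f (LinearMap.ker (f e))) : IsConnectedOn f' (LinearMap.ker (f' e)) := by
  by_contra he'
  obtain ⟨⟨u, hu0, hu1⟩, P', Q', hs⟩ := exists_isSeparation_of_not_isConnectedOn hspan' he'
  have hPe : P' ≤ LinearMap.ker (f' e) := hs.sup_eq ▸ le_sup_left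
  have hQe : Q' ≤ LinearMap.ker (f' e) := hs.sup_eq ▸ le_sup_right
  let I : Set ι := {i | P' ≤ LinearMap.ker (f' i)}
  let J : Set ι := {i | Q' ≤ LinearMap.ker (f' i)}
  have hPI : finrank k P' ≤ finrank k (commonKer f I) :=
    (finrank_mono (show P' ≤ commonKer f' I from
      fun v hv => mem_commonKer.2 fun i hi => hi hv)).trans (finrank_commonKer_le hdim h I)
  have hQJ : finrank k Q' ≤ finrank k (commonKer f J) :=
    (finrank_mono (show Q' ≤ commonKer f' J from
      fun v hv => mem_commonKer.2 fun i hi => hi hv)).trans (finrank_commonKer_le hdim h J)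
  have hcov : ∀ i, commonKer f I ≤ LinearMap.ker (f i) ∨ commonKer f J ≤ LinearMap.ker (f i) :=
    fun i => (hs.le_ker i).imp (fun hi v hv => mem_commonKer.1 hv i hi)
      (fun hi v hv => mem_commonKer.1 hv i hi)
  have hP0 : finrank k P' ≠ 0 := fun h0 => hs.left_ne_bot (finrank_eq_zero.1 h0)
  have hQ0 : finrank k Q' ≠ 0 := fun h0 => hs.right_ne_bot (finrank_eq_zero.1 h0)
  refine IsSeparation.not_isConnectedOn (P := commonKer f I) (Q := commonKer f J) hspan
    ⟨?_, fun h0 => ?_, fun h0 => ?_, hcov⟩ hu0 hu1 he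
  · apply eq_of_le_of_finrank_le
      (sup_le (fun v hv => mem_commonKer.1 hv e hPe) (fun v hv => mem_commonKer.1 hv e hQe))
    have h1 := finrank_sup_add_finrank_inf_eq P' Q'
    have h2 := finrank_sup_add_finrank_inf_eq (commonKer f I) (commonKer f J)
    rw [hs.sup_eq, (disjoint_of_forall_le_ker hspan' hs.le_ker).eq_bot, finrank_bot] at h1
    rw [(disjoint_of_forall_le_ker hspan hcov).eq_bot, finrank_bot] at h2
    have h3 := Module.Dual.finrank_ker_add_one_of_ne_zero (hf0 e)
    have h4 := Module.Dual.finrank_ker_add_one_of_ne_zero (hf0' e)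
    omega
  · rw [h0, finrank_bot] at hPI
    omega
  · rw [h0, finrank_bot] at hQJ
    omega

/-- Exchange: a nonzero functional can be swapped into an independent set of full size. -/
theorem LinearIndepOn.exists_exchange [Finite ι] {f : ι → (V →ₗ[k] k)} {S : Set ι}
    (hS : LinearIndepOn k f S) (hcard : S.ncard = finrank k V) {c : ι} (hc : f c ≠ 0) :
    ∃ T ⊆ insert c S, c ∈ T ∧ LinearIndepOn k f T ∧ T.ncard = finrank k V := by
  obtain ⟨T, hT, hcT, hspan, hTi⟩ := exists_linearIndepOn_extension
    ((linearIndepOn_singleton_iff k).2 hc) (Set.singleton_subset_iff.2 (Set.mem_insert c S))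
  refine ⟨T, hT, hcT rfl, hTi, ?_⟩
  have h1 := linearIndepOn_iff_finrank_commonKer_add_ncard.1 hS
  have h2 := linearIndepOn_iff_finrank_commonKer_add_ncard.1 hTi
  have h3 : commonKer f T ≤ commonKer f S := dualCoannihilator_anti <|
    (span_mono (Set.image_mono (Set.subset_insert c S))).trans (span_le.2 hspan)
  have h4 := finrank_mono h3
  omega

/-- There is a member `c` of the more constrained configuration `f` at which the restriction is
connected, and a set containing `c` which is independent for `f'` but not for `f`, and in which
no other member is proportional to `f c`. -/
theorem exists_isConnectedOn_and_dependent [Finite ι]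
    {f : ι → (V →ₗ[k] k)} {f' : ι → (V' →ₗ[k] k)}
    (hdim : finrank k V = finrank k V') (hV : 2 < finrank k V)
    (hf0 : ∀ i, f i ≠ 0) (hf0' : ∀ i, f' i ≠ 0)
    (hspan : ∀ v, (∀ i, f i v = 0) → v = 0) (hspan' : ∀ v, (∀ i, f' i v = 0) → v = 0)
    (hconn : IsConnectedConfig k Set.univ f)
    (hdep : ∃ S : Set ι, LinearIndepOn k f' S ∧ ¬ LinearIndepOn k f S) :
    ∃ c, IsConnectedOn f (LinearMap.ker (f c)) ∧ ∃ S : Set ι, c ∈ S ∧ LinearIndepOn k f' S ∧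
      ¬ LinearIndepOn k f S ∧ ∀ i ∈ S, LinearMap.ker (f i) = LinearMap.ker (f c) → i = c := by
  by_contra! hcon
  obtain ⟨S₀, hS₀', hS₀⟩ := hdep
  obtain ⟨S, -, hS₀S, hSspan, hS'⟩ := exists_linearIndepOn_extension hS₀' (Set.subset_univ S₀)
  have hS : ¬ LinearIndepOn k f S := fun h => hS₀ (h.mono hS₀S)
  have hcard : S.ncard = finrank k V' := by
    have h1 := linearIndepOn_iff_finrank_commonKer_add_ncard.1 hS'
    have h2 : commonKer f' S ≤ commonKer f' Set.univ :=
      dualCoannihilator_anti (span_le.2 hSspan)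
    have h3 : commonKer f' S = ⊥ := eq_bot_iff.2 fun v hv =>
      hspan' v fun i => mem_commonKer.1 (h2 hv) i trivial
    rwa [h3, finrank_bot, zero_add] at h1
  -- a nonzero vector on all the hyperplanes of `S`
  obtain ⟨u, huS, hu0⟩ : ∃ u, (∀ i ∈ S, f i u = 0) ∧ u ≠ 0 := by
    by_contra! hno
    have : commonKer f S = ⊥ := eq_bot_iff.2 fun v hv => hno v (mem_commonKer.1 hv)
    apply hS
    rw [linearIndepOn_iff_finrank_commonKer_add_ncard, this, finrank_bot, zero_add, hcard, hdim]
  have hdepu : ∀ T : Set ι, T.ncard = finrank k V' → ∀ w, w ≠ 0 → (∀ i ∈ T, f i w = 0) →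
      ¬ LinearIndepOn k f T := by
    intro T hT w hw0 hw hTi
    have h1 := linearIndepOn_iff_finrank_commonKer_add_ncard.1 hTi
    have h2 : finrank k (commonKer f T) = 0 := by omega
    have h3 : w ∈ commonKer f T := mem_commonKer.2 hw
    rw [finrank_eq_zero.1 h2] at h3
    exact hw0 (by simpa using h3)
  obtain ⟨c, hc, hcu⟩ := exists_isConnectedOn hf0 hspan hconn hu0
  have hcS : c ∉ S := fun h => hcu (huS c h)
  obtain ⟨T, hTS, hcT, hT', hTcard⟩ := hS'.exists_exchange hcard (hf0' c)
  have hTS' : T \ {c} ⊆ S := fun i hi => (hTS hi.1).resolve_left hi.2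
  have hT : LinearIndepOn k f T := by
    by_contra hT
    obtain ⟨i, hiT, hik, hic⟩ := hcon c hc T hcT hT' hT
    have hiu : u ∈ LinearMap.ker (f i) := huS i (hTS' ⟨hiT, hic⟩)
    rw [hik] at hiu
    exact hcu hiu
  have hpair : ∀ i ∈ T, ∀ j ∈ T, LinearMap.ker (f i) = LinearMap.ker (f j) → i = j := by
    intro i hi j hj hij
    by_contra hne
    exact (linearIndepOn_pair_iff_ker_ne hne (hf0 i) (hf0 j)).1
      (hT.mono (Set.insert_subset hi (Set.singleton_subset_iff.2 hj))) hij
  -- `S` has a single element outside `T`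
  have hTc : (T \ {c}).ncard + 1 = T.ncard := Set.ncard_sdiff_singleton_add_one hcT
  obtain ⟨x, hx⟩ : ∃ x, S \ (T \ {c}) = {x} := by
    rw [← Set.ncard_eq_one]
    have := Set.ncard_sdiff_add_ncard_of_subset hTS'
    omega
  have hmem : ∀ i ∈ S, i ∈ T \ {c} ∨ i = x := by
    intro i hi
    by_cases h : i ∈ T \ {c}
    · exact Or.inl h
    · right
      have : i ∈ S \ (T \ {c}) := ⟨hi, h⟩
      rwa [hx] at this
  have hparallel : ∀ d, IsConnectedOn f (LinearMap.ker (f d)) → f d u = 0 →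
      LinearMap.ker (f d) = LinearMap.ker (f x) := by
    intro d hd hdu
    obtain ⟨y, hyS, hyd⟩ : ∃ y ∈ S, LinearMap.ker (f y) = LinearMap.ker (f d) := by
      by_contra! hno
      obtain ⟨R, hRS, hdR, hR', hRcard⟩ := hS'.exists_exchange hcard (hf0' d)
      obtain ⟨i, hiR, hik, hid⟩ := hcon d hd R hdR hR' <| hdepu R hRcard u hu0 fun i hi => by
        rcases hRS hi with rfl | hi
        · exact hdu
        · exact huS i hi
      exact hno i ((hRS hiR).resolve_left hid) hik
    obtain ⟨z, hzS, hzy, hne⟩ := hcon y (hyd ▸ hd) S hyS hS' hS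
    rcases hmem y hyS with hy | rfl
    · rcases hmem z hzS with hz | rfl
      · exact absurd (hpair z hz.1 y hy.1 hzy) hne
      · rw [hzy, hyd]
    · exact hyd.symm
  -- a member of `S` not parallel to `x`
  obtain ⟨e, heT, hex⟩ : ∃ e ∈ T \ {c}, LinearMap.ker (f e) ≠ LinearMap.ker (f x) := by
    obtain ⟨a, ha, b, hb, hab⟩ := (Set.one_lt_ncard (s := T \ {c})).1 (by omega)
    by_cases hax : LinearMap.ker (f a) = LinearMap.ker (f x)
    · exact ⟨b, hb, fun hbx => hab (hpair a ha.1 b hb.1 (hax.trans hbx.symm))⟩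
    · exact ⟨a, ha, hax⟩
  have he : ¬ IsConnectedOn f (LinearMap.ker (f e)) := fun he =>
    hex (hparallel e he (huS e (hTS' heT)))
  have hline : ∀ w, (∀ i ∈ S, f i w = 0) → ∃ a : k, a • u = w := by
    intro w hw
    refine ⟨f c w / f c u, ?_⟩
    by_contra hne
    refine hdepu T hTcard _ (sub_ne_zero.2 hne) (fun i hi => ?_) hT
    by_cases hic : i = c
    · subst hic
      simp [hcu]
    · have hiS := hTS' ⟨hi, hic⟩
      simp [hw i hiS, huS i hiS]
  obtain ⟨P, Q, hs, hP, hQ⟩ := exists_isSeparation_and_isConnectedOn hf0 hspan hconn he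
  have hfinish : ∀ P Q : Submodule k V, IsSeparation f e P Q →
      (∀ w ∉ P, ∃ c, IsConnectedOn f (LinearMap.ker (f c)) ∧
        P ≤ LinearMap.ker (f c) ∧ f c w ≠ 0) → u ∉ P := by
    intro P Q hs hP huP
    have hPe : P ≤ LinearMap.ker (f e) := hs.sup_eq ▸ le_sup_left
    obtain ⟨w, hwx, hwP⟩ : ∃ w ∈ LinearMap.ker (f x), w ∉ P := by
      by_contra! hle
      exact hex (ker_eq_of_ker_le (hf0 e) fun w hw => hPe (hle w hw)).symm
    obtain ⟨d, hd, hPd, hdw⟩ := hP w hwP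
    have := hparallel d hd (hPd huP)
    rw [← this] at hwx
    exact hdw hwx
  have hue : u ∈ P ⊔ Q := by
    rw [hs.sup_eq]
    exact huS e (hTS' heT)
  obtain ⟨p, hp, q, hq, hpq⟩ := mem_sup.1 hue
  have hpS : ∀ i ∈ S, f i p = 0 := by
    intro i hi
    rcases hs.le_ker i with h | h
    · exact h hp
    · have h1 : f i q = 0 := h hq
      have h2 := huS i hi
      rwa [← hpq, map_add, h1, add_zero] at h2
  obtain ⟨a, rfl⟩ := hline p hpS
  by_cases ha : a = 0
  · rw [ha, zero_smul, zero_add] at hpq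
    exact hfinish Q P hs.symm hQ (hpq ▸ hq)
  · exact hfinish P Q hs hP ((smul_mem_iff _ ha).1 hp)

end Comparison

/-- Lemma (restriction step): let `r > 2` and let `H = (f i)`, `H' = (f' i)` be connected
configurations of `n` hyperplanes in `P^{r-1}` with `H` more constrained than `H'`.
Then there is an index `i₀` such that, with `W = ker (f i₀)`, `W' = ker (f' i₀)`,
`M = {i ≠ i₀ : f i |_W ≠ 0}` and `M' = {i ≠ i₀ : f' i |_{W'} ≠ 0}`, one has `M ⊆ M'`,
both restricted configurations `R_{i₀}(H)` and `R_{i₀}(H')` are connected, and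
`R_{i₀}(H)` is more constrained than `R_{i₀}(H')` (compared over the index set `M`). -/
theorem exists_restriction_more_constrained
    {k : Type*} [Field k] {r n : ℕ} (hr : 2 < r) (hn : 1 ≤ n)
    (f f' : Fin n → ((Fin r → k) →ₗ[k] k))
    (hf0 : ∀ i, f i ≠ 0) (hf0' : ∀ i, f' i ≠ 0)
    (hconn : IsConnectedConfig k Set.univ f)
    (hconn' : IsConnectedConfig k Set.univ f')
    (hmc : MoreConstrainedOn k Set.univ f f') :
    ∃ i₀ : Fin n,
      {i : Fin n | i ≠ i₀ ∧ (f i).domRestrict (LinearMap.ker (f i₀)) ≠ 0} ⊆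
        {i : Fin n | i ≠ i₀ ∧ (f' i).domRestrict (LinearMap.ker (f' i₀)) ≠ 0} ∧
      IsConnectedConfig k {i : Fin n | i ≠ i₀ ∧ (f i).domRestrict (LinearMap.ker (f i₀)) ≠ 0}
        (fun i => (f i).domRestrict (LinearMap.ker (f i₀))) ∧
      IsConnectedConfig k {i : Fin n | i ≠ i₀ ∧ (f' i).domRestrict (LinearMap.ker (f' i₀)) ≠ 0}
        (fun i => (f' i).domRestrict (LinearMap.ker (f' i₀))) ∧
      MoreConstrainedOn k {i : Fin n | i ≠ i₀ ∧ (f i).domRestrict (LinearMap.ker (f i₀)) ≠ 0}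
        (fun i => (f i).domRestrict (LinearMap.ker (f i₀)))
        (fun i => (f' i).domRestrict (LinearMap.ker (f' i₀))) := by
  have hdim : finrank k (Fin r → k) = finrank k (Fin r → k) := rfl
  have hV : finrank k (Fin r → k) = r := by simp
  have hspan := hconn.eq_zero_of_forall (by omega)
  have hspan' := hconn'.eq_zero_of_forall (by omega)
  have hle : ∀ S : Set (Fin n), LinearIndepOn k f S → LinearIndepOn k f' S :=
    fun S => hmc.1 S (Set.subset_univ S)
  obtain ⟨S₀, -, hS₀', hS₀⟩ := hmc.2
  obtain ⟨c, hc, S, hcS, hS', hS, hpar⟩ := exists_isConnectedOn_and_dependent hdim (by omega)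
    hf0 hf0' hspan hspan' hconn ⟨S₀, hS₀', hS₀⟩
  have hne : ∀ (h : Fin n → ((Fin r → k) →ₗ[k] k)), (∀ i, h i ≠ 0) → ∀ i, i ≠ c →
      ((h i).domRestrict (LinearMap.ker (h c)) ≠ 0 ↔ LinearIndepOn k h {i, c}) := by
    intro h h0 i hi
    rw [linearIndepOn_pair_iff_ker_ne hi (h0 i) (h0 c), not_iff_not]
    constructor
    · intro hz
      exact (ker_eq_of_ker_le (h0 i) fun x hx => LinearMap.congr_fun hz ⟨x, hx⟩).symm
    · intro hk
      ext x
      exact hk.ge x.2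
  refine ⟨c, fun i hi => ⟨hi.1, (hne f' hf0' i hi.1).2 (hle _ ((hne f hf0 i hi.1).1 hi.2))⟩,
    ?_, ?_, fun R hR hRi => ?_, S \ {c}, fun i hi => ⟨hi.2, ?_⟩, ?_, ?_⟩
  · rw [setOf_ne_and_domRestrict_ne_zero]
    exact hc
  · rw [setOf_ne_and_domRestrict_ne_zero]
    exact hc.of_le hdim hf0 hf0' hspan hspan' hle
  · have hcR : c ∉ R := fun h => (hR h).1 rfl
    exact (linearIndepOn_domRestrict_ker_iff (hf0' c) hcR).2
      (hle _ ((linearIndepOn_domRestrict_ker_iff (hf0 c) hcR).1 hRi))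
  · rw [hne f hf0 i hi.2, linearIndepOn_pair_iff_ker_ne hi.2 (hf0 i) (hf0 c)]
    exact fun hk => hi.2 (hpar i hi.1 hk)
  · refine (linearIndepOn_domRestrict_ker_iff (hf0' c) (fun h => h.2 rfl)).2 ?_
    rwa [Set.insert_sdiff_singleton, Set.insert_eq_of_mem hcS]
  · intro h
    have := (linearIndepOn_domRestrict_ker_iff (hf0 c) (fun h => h.2 rfl)).1 h
    rw [Set.insert_sdiff_singleton, Set.insert_eq_of_mem hcS] at this
    exact hS this
end

section
/- Let k be a field and n > 4. Let v = (v_i)_{i∈N} and v' = (v'_i)_{i∈N}, N = {1,…,n}, be two families of nonzero vectors in k² (configurations of n points in P¹, repetitions allowed). Assume both configurations are connected, i.e. the only g ∈ GL₂(k) with g·v_i ∈ k^×·v_i for all i ∈ N are the scalar maps, and assume v is more constrained than v': for all i, j ∈ N, if v_i and v_j are linearly independent then v'_i and v'_j are linearly independent, and there exist i, j ∈ N with v'_i, v'_j linearly independent but v_i, v_j linearly dependent. Then there exists an index i₀ ∈ N such that the contracted configurations C_{i₀}(v) = (v_i)_{i∈N∖{i₀}} and C_{i₀}(v') = (v'_i)_{i∈N∖{i₀}}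 are both connected and C_{i₀}(v) is more constrained than C_{i₀}(v'). -/
/-- A configuration of points of `P¹` (nonzero vectors of `k²`, repetitions allowed)
indexed by `M ⊆ ι` is *connected* (has no projective automorphisms) if the only linear
automorphisms `g ∈ GL₂(k)` with `g · v i ∈ kˣ · v i` for all `i ∈ M` are the scalar
maps. -/
def IsConnectedPointConfig (k : Type*) [Field k] {ι : Type*}
    (M : Set ι) (v : ι → (Fin 2 → k)) : Prop :=
  ∀ g : (Fin 2 → k) ≃ₗ[k] (Fin 2 → k),
    (∀ i ∈ M, ∃ c : kˣ, g (v i) = (c : k) • v i) →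
    ∃ c : kˣ, ∀ w : Fin 2 → k, g w = (c : k) • w

/-- A configuration `v` of points of `P¹` is *more constrained* than `v'` over the index
set `M`: whenever `v i, v j` are linearly independent so are `v' i, v' j`, and for some
`i, j ∈ M` the pair `v' i, v' j` is linearly independent while `v i, v j` is linearly
dependent. -/
def MoreConstrainedPoints (k : Type*) [Field k] {ι : Type*}
    (M : Set ι) (v v' : ι → (Fin 2 → k)) : Prop :=
  (∀ i ∈ M, ∀ j ∈ M, LinearIndependent k ![v i, v j] → LinearIndependent k ![v' i, v' j]) ∧
  ∃ i ∈ M, ∃ j ∈ M, LinearIndependent k ![v' i, v' j] ∧ ¬ LinearIndependent k ![v i, v j]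

/-- The determinant of a pair of plane vectors. -/
def planeDet {k : Type*} [Field k] (x y : Fin 2 → k) : k := x 0 * y 1 - x 1 * y 0

theorem linearIndependent_pair_iff_planeDet_ne_zero {k : Type*} [Field k] (x y : Fin 2 → k) :
    LinearIndependent k ![x, y] ↔ planeDet x y ≠ 0 := by
  have h := Matrix.linearIndependent_rows_iff_isUnit (A := Matrix.of ![x, y])
  rw [Matrix.isUnit_iff_isUnit_det, isUnit_iff_ne_zero, Matrix.det_fin_two] at h
  have e : planeDet x y = x 0 * y 1 - y 0 * x 1 := by unfold planeDet; ring
  rw [e]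
  simpa [mul_comm] using h

theorem planeDet_smul_eq {k : Type*} [Field k] (x y w : Fin 2 → k) :
    planeDet x y • w = planeDet w y • x + planeDet x w • y := by
  ext j
  fin_cases j <;> simp [planeDet] <;> ring

theorem eq_zero_of_planeDet_eq_zero {k : Type*} [Field k] {x : Fin 2 → k}
    (h : ∀ w, planeDet x w = 0) : x = 0 := by
  ext j
  fin_cases j
  · simpa [planeDet] using h ![0, 1]
  · simpa [planeDet] using h ![1, 0]

theorem exists_unit_smul_of_planeDet_eq_zero {k : Type*} [Field k] {x y : Fin 2 → k}
    (hx : x ≠ 0) (hy : y ≠ 0) (h : planeDet x y = 0) : ∃ c : kˣ, y = (c : k) • x := by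
  obtain ⟨w, hw⟩ : ∃ w, planeDet x w ≠ 0 := by
    by_contra! hw
    exact hx (eq_zero_of_planeDet_eq_zero hw)
  have e := planeDet_smul_eq x w y
  rw [h, zero_smul, add_zero] at e
  have e' : y = (planeDet y w / planeDet x w) • x := by
    rw [div_eq_inv_mul, mul_smul, ← e, smul_smul, inv_mul_cancel₀ hw, one_smul]
  refine ⟨Units.mk0 (planeDet y w / planeDet x w) fun h0 ↦ hy ?_, e'⟩
  rw [e', h0, zero_smul]

/-- The map `w ↦ w + s • det (x, w) • y`. -/
def planeShear {k : Type*} [Field k] (s : k) (x y : Fin 2 → k) :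
    (Fin 2 → k) →ₗ[k] (Fin 2 → k) where
  toFun w := w + (s * planeDet x w) • y
  map_add' a b := by ext j; simp [planeDet]; ring
  map_smul' c a := by ext j; simp [planeDet]; ring

theorem planeShear_injective {k : Type*} [Field k] {s : k} {x y : Fin 2 → k}
    (h : 1 + s * planeDet x y ≠ 0) : Function.Injective (planeShear s x y) := by
  refine (injective_iff_map_eq_zero _).2 fun w hw ↦ ?_
  replace hw : w + (s * planeDet x w) • y = 0 := hw
  have hd : planeDet x (w + (s * planeDet x w) • y) =
      (1 + s * planeDet x y) * planeDet x w := by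
    simp [planeDet]; ring
  have h0 : planeDet x w = 0 := by
    rw [hw] at hd
    have : (1 + s * planeDet x y) * planeDet x w = 0 := by rw [← hd]; simp [planeDet]
    exact (mul_eq_zero.1 this).resolve_left h
  simpa [h0] using hw

theorem IsConnectedPointConfig.exists_planeDet_ne_zero {k : Type*} [Field k] {ι : Type*}
    {M : Set ι} {v : ι → (Fin 2 → k)} (hM : IsConnectedPointConfig k M v)
    (hv : ∀ i ∈ M, v i ≠ 0) {s : k} (hs : s ≠ 0) {x y : Fin 2 → k} (hx : x ≠ 0) (hy : y ≠ 0)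
    (h : 1 + s * planeDet x y ≠ 0) :
    ∃ i ∈ M, planeDet x (v i) ≠ 0 ∧ planeDet y (v i) ≠ 0 := by
  by_contra! hne
  obtain ⟨c, hc⟩ := hM (LinearEquiv.ofInjectiveEndo _ (planeShear_injective h)) fun i hi ↦ by
    change ∃ c : kˣ, v i + (s * planeDet x (v i)) • y = (c : k) • v i
    by_cases hxi : planeDet x (v i) = 0
    · exact ⟨1, by simp [hxi]⟩
    · obtain ⟨c, hc⟩ := exists_unit_smul_of_planeDet_eq_zero hy (hv i hi) (hne i hi hxi)
      refine ⟨Units.mk0 _ h, ?_⟩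
      rw [hc, Units.val_mk0, smul_smul, ← add_smul]
      congr 1
      simp [planeDet]; ring
  replace hc : ∀ w, w + (s * planeDet x w) • y = (c : k) • w := hc
  have hc1 : (c : k) = 1 := by
    have hxx := hc x
    rw [show planeDet x x = 0 by unfold planeDet; ring, mul_zero, zero_smul, add_zero] at hxx
    refine smul_left_injective k hx ?_
    simpa using hxx.symm
  refine hx (eq_zero_of_planeDet_eq_zero fun w ↦ ?_)
  have hw := hc w
  rw [hc1, one_smul, add_eq_left, smul_eq_zero] at hw
  simpa [hs, hy] using hw

theorem exists_eq_smul_of_planeDet_ne_zero {k : Type*} [Field k]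
    (g : (Fin 2 → k) ≃ₗ[k] (Fin 2 → k)) {x y : Fin 2 → k} {c : kˣ}
    (hxy : planeDet x y ≠ 0) (hx : g x = (c : k) • x) (hy : g y = (c : k) • y) :
    ∃ c : kˣ, ∀ w : Fin 2 → k, g w = (c : k) • w := by
  refine ⟨c, fun w ↦ smul_right_injective _ hxy ?_⟩
  change planeDet x y • g w = planeDet x y • (c : k) • w
  rw [← map_smul, smul_comm, planeDet_smul_eq, map_add, map_smul, map_smul, hx, hy, smul_add,
    smul_comm (c : k), smul_comm (c : k)]

theorem isConnectedPointConfig_of_three {k : Type*} [Field k] {ι : Type*}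
    {M : Set ι} {v : ι → (Fin 2 → k)} {i a b : ι} (hi : i ∈ M) (ha : a ∈ M) (hb : b ∈ M)
    (hia : planeDet (v i) (v a) ≠ 0) (hib : planeDet (v i) (v b) ≠ 0)
    (hab : planeDet (v a) (v b) ≠ 0) : IsConnectedPointConfig k M v := by
  intro g hg
  obtain ⟨ci, hci⟩ := hg i hi
  obtain ⟨ca, hca⟩ := hg a ha
  obtain ⟨cb, hcb⟩ := hg b hb
  have e := congrArg g (planeDet_smul_eq (v i) (v a) (v b))
  rw [map_add, map_smul, map_smul, map_smul, hci, hca, hcb] at e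
  have e0 := congrFun e 0
  have e1 := congrFun e 1
  simp only [Pi.smul_apply, Pi.add_apply, smul_eq_mul] at e0 e1
  have hbi : (cb : k) = ci := by
    refine mul_left_cancel₀ (mul_ne_zero hia hab) ?_
    unfold planeDet at *
    linear_combination v a 0 * e1 - v a 1 * e0
  have hba : (cb : k) = ca := by
    refine mul_left_cancel₀ (mul_ne_zero hia hib) ?_
    unfold planeDet at *
    linear_combination v i 0 * e1 - v i 1 * e0
  have hcc : (ca : k) = ci := hba.symm.trans hbi
  exact exists_eq_smul_of_planeDet_ne_zero g hia hci (by rw [hca, hcc])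

theorem isConnectedPointConfig_of_two {k : Type*} [Field k] {ι : Type*}
    {M : Set ι} {v : ι → (Fin 2 → k)} (hk : ∀ u : kˣ, u = 1) {i a : ι} (hi : i ∈ M) (ha : a ∈ M)
    (hia : planeDet (v i) (v a) ≠ 0) : IsConnectedPointConfig k M v := by
  intro g hg
  obtain ⟨ci, hci⟩ := hg i hi
  obtain ⟨ca, hca⟩ := hg a ha
  exact exists_eq_smul_of_planeDet_ne_zero g hia hci (by rw [hca, hk ca, hk ci])

/-- Lemma (contraction step for points of `P¹`): let `n > 4` and let `v, v'` be connected
configurations of `n` points of `P¹` such that `v` is more constrained than `v'`.  Then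
there is an index `i₀` such that the contracted configurations `C_{i₀}(v)` and
`C_{i₀}(v')` (delete the index `i₀`) are both connected and `C_{i₀}(v)` is more
constrained than `C_{i₀}(v')`. -/
theorem exists_contraction_more_constrained
    {k : Type*} [Field k] {n : ℕ} (hn : 4 < n)
    (v v' : Fin n → (Fin 2 → k))
    (hv0 : ∀ i, v i ≠ 0) (hv0' : ∀ i, v' i ≠ 0)
    (hconn : IsConnectedPointConfig k Set.univ v)
    (hconn' : IsConnectedPointConfig k Set.univ v')
    (hmc : MoreConstrainedPoints k Set.univ v v') :
    ∃ i₀ : Fin n,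
      IsConnectedPointConfig k {i : Fin n | i ≠ i₀} v ∧
      IsConnectedPointConfig k {i : Fin n | i ≠ i₀} v' ∧
      MoreConstrainedPoints k {i : Fin n | i ≠ i₀} v v' := by
  obtain ⟨hind, i, -, j, -, hij', hij⟩ := hmc
  have hind' : ∀ p q, planeDet (v p) (v q) ≠ 0 → planeDet (v' p) (v' q) ≠ 0 := fun p q h ↦
    (linearIndependent_pair_iff_planeDet_ne_zero _ _).1 <| hind p trivial q trivial <|
      (linearIndependent_pair_iff_planeDet_ne_zero _ _).2 h
  obtain ⟨a, -, hia, -⟩ := hconn.exists_planeDet_ne_zero (fun p _ ↦ hv0 p) one_ne_zero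
    (hv0 i) (hv0 i) (by simp [planeDet, mul_comm])
  have hmore : ∀ i₀, i ≠ i₀ → j ≠ i₀ → MoreConstrainedPoints k {i : Fin n | i ≠ i₀} v v' :=
    fun i₀ hi hj ↦ ⟨fun p _ q _ ↦ hind p trivial q trivial, i, hi, j, hj, hij', hij⟩
  have hpick : ∀ b, ∃ i₀, i ≠ i₀ ∧ j ≠ i₀ ∧ a ≠ i₀ ∧ b ≠ i₀ := by
    intro b
    obtain ⟨i₀, h₀⟩ := Finset.exists_mem_notMem_of_card_lt_card
      (s := {i, j, a, b}) (t := (Finset.univ : Finset (Fin n)))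
      (Finset.card_le_four.trans_lt (by simpa using hn))
    refine ⟨i₀, ?_⟩
    simpa [eq_comm] using h₀
  by_cases hk : ∀ u : kˣ, u = 1
  · obtain ⟨i₀, hi, hj, ha, -⟩ := hpick a
    exact ⟨i₀, isConnectedPointConfig_of_two hk hi ha hia,
      isConnectedPointConfig_of_two hk hi ha (hind' _ _ hia), hmore i₀ hi hj⟩
  · push Not at hk
    obtain ⟨u, hu⟩ := hk
    have hu' : (u : k) - 1 ≠ 0 := sub_ne_zero.2 fun h ↦ hu (Units.ext h)
    obtain ⟨b, -, hib, hab⟩ := hconn.exists_planeDet_ne_zero (fun p _ ↦ hv0 p)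
      (div_ne_zero hu' hia) (hv0 i) (hv0 a) (by rw [div_mul_cancel₀ _ hia]; simp)
    obtain ⟨i₀, hi, hj, ha, hb⟩ := hpick b
    exact ⟨i₀, isConnectedPointConfig_of_three hi ha hb hia hib hab,
      isConnectedPointConfig_of_three hi ha hb (hind' _ _ hia) (hind' _ _ hib) (hind' _ _ hab),
      hmore i₀ hi hj⟩
end
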